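/- Let X ⊂ ℂ³ be the hypersurface φ = x³ + x²y² + y⁷ + z² = 0 and f = (f₁,f₂) = (y+z², x²+xy+y²). Let Δ be the determinant of the Jacobian of (φ,f₁,f₂) : ℂ³ → ℂ³ and J(φ,f,Δ) the ideal of 3×3 minors of the Jacobian of (φ,f₁,f₂,Δ) : ℂ³ → ℂ⁴. Then c(f|_X) := dim_ℂ O₃/(⟨φ⟩ + J(φ,f,Δ)) = 9. -/

import Mathlib

/-!  STATEMENT 14.  `O₃ = MvPowerSeries (Fin 3) ℂ` with `x = X 0`, `y = X 1`,
`z = X 2`; `pd` is the partial derivative.  For `φ = x³ + x²y² + y⁷ + z²` and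
`f = (f₁,f₂) = (y + z², x² + xy + y²)`, let `Δ = det d(φ,f₁,f₂)` and let
`J(φ,f,Δ)` be the ideal of `3×3` minors of the Jacobian of `(φ,f₁,f₂,Δ)`.
Then `c(f|_X) = dim_ℂ O₃/(⟨φ⟩ + J(φ,f,Δ)) = 9`. -/

noncomputable def pd {σ : Type*} [DecidableEq σ] (i : σ)
    (f : MvPowerSeries σ ℂ) : MvPowerSeries σ ℂ :=
  fun m => ((m i : ℂ) + 1) * f (m + Finsupp.single i 1)

open MvPowerSeries

set_option linter.unusedSimpArgs false

structure Deg4 {R : Type*} [CommRing R] (x y z : R) : Prop where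
  a1 : x^4 = 0
  a2 : x^3*y = 0
  a3 : x^2*y^2 = 0
  a4 : x*y^3 = 0
  a5 : y^4 = 0
  b1 : x^3*z = 0
  b2 : x^2*y*z = 0
  b3 : x*y^2*z = 0
  b4 : y^3*z = 0
  c1 : x^2*z^2 = 0
  c2 : x*y*z^2 = 0
  c3 : y^2*z^2 = 0
  d1 : x*z^3 = 0
  d2 : y*z^3 = 0
  e1 : z^4 = 0

theorem fwd {R : Type*} [CommRing R] (x y z t : R) (ht : 4*t = 1)
  (h1 : (2*x+y)*z = 0) (h2 : (2*x+y)^2 = 0) (h3 : 4*z^2 = 3*x^2*(2*x+y)) (h4 : x^3+z^2=0) :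
  z^2*y=0 ∧ Deg4 x y z := by
  have e1 : x^3*(2*x+y) = 0 := by linear_combination (2*x+y)*h4 - z*h1
  have e2 : z^2*x = 0 := by linear_combination t*x*h3-z^2*x*ht +3*t*e1
  have e3 : z^3 = 0 := by linear_combination t*z*h3-z^3*ht +3*t*x^2*h1
  have e4 : x^4 = 0 := by linear_combination x*h4 - e2
  have e5 : x^3*y = 0 := by linear_combination e1 - 2*e4
  have e6 : x^2*y^2 = 0 := by linear_combination x^2*h2 - 4*e4-4*e5
  have e7 : x*y^3 = 0 := by linear_combination x*y*h2 - 4*e5-4*e6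
  have e8 : y^4 = 0 := by linear_combination y^2*h2 - 4*e6-4*e7
  refine ⟨?_, e4, e5, e6, e7, e8, ?_, ?_, ?_, ?_, ?_, ?_, ?_, ?_, ?_, ?_⟩ <;> grind

theorem red {R : Type*} [CommRing R] (x y z a b q D Dx Dy : R) (H : Deg4 x y z)
   (ha : a = 3*x^2+2*x*y^2) (hb : b = 2*x^2*y+7*y^6) (hq : q = x + 2*y)
   (hD : D = -(2*x+y)+b*(2*x+y)-a*q)
   (hDx : Dx = -2 + (4*x*y)*(2*x+y)+2*b - (6*x+2*y^2)*q - a)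
   (hDy : Dy = -1 + (2*x^2+42*y^5)*(2*x+y)+b - (4*x*y)*q - 2*a) :
   -2*(2*x+y)*D+4*z^2*((2*x+y)*Dy - q*Dx) = 2*(2*x+y)^2+12*z^2*y ∧
   2*D*(a*q-b*(2*x+y))+4*z^2*((2*x+y)*Dy - q*Dx) = 12*z^2*y ∧
   2*a*D+4*z^2*(b*Dx-a*Dy-Dx) = -6*x^2*(2*x+y)+8*z^2 ∧ 
   2*z*D = -2*((2*x+y)*z) ∧ x^3+x^2*y^2+y^7+z^2=x^3+z^2 := by
  obtain ⟨a1,a2,a3,a4,a5,b1,b2,b3,b4,c1,c2,c3,d1,d2,e1⟩ := H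
  have hb2 : b*(2*x+y) = 0 := by rw [hb]; clear * - a1 a2 a3 a4 a5 b1 b2 b3 b4 c1 c2 c3 d1 d2 e1; grind
  have haq : a*q = 3*x^2*q := by rw [ha, hq]; clear * - a1 a2 a3 a4 a5 b1 b2 b3 b4 c1 c2 c3 d1 d2 e1; grind
  have hD' : D = -(2*x+y)-3*x^2*q := by rw [hD, hb2, haq]; ring
  have hzb : z^2*b = 0 := by rw [hb]; clear * - a1 a2 a3 a4 a5 b1 b2 b3 b4 c1 c2 c3 d1 d2 e1; grind
  have hza : z^2*a = 0 := by rw [ha]; clear * - a1 a2 a3 a4 a5 b1 b2 b3 b4 c1 c2 c3 d1 d2 e1; grind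
  have hzx : z^2*Dx = -2*z^2 := by
    have : z^2*Dx = z^2*(-2 + (4*x*y)*(2*x+y) - (6*x+2*y^2)*q) + 2*(z^2*b) - z^2*a := by
      rw [hDx]; ring
    rw [this, hzb, hza, hq]; clear * - a1 a2 a3 a4 a5 b1 b2 b3 b4 c1 c2 c3 d1 d2 e1; grind
  have hzy : z^2*Dy = -z^2 := by
    have : z^2*Dy = z^2*(-1 + (2*x^2+42*y^5)*(2*x+y) - (4*x*y)*q) + (z^2*b) - 2*(z^2*a) := by
      rw [hDy]; ring
    rw [this, hzb, hza, hq]; clear * - a1 a2 a3 a4 a5 b1 b2 b3 b4 c1 c2 c3 d1 d2 e1; grind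
  have hk : 4*z^2*((2*x+y)*Dy - q*Dx) = 12*z^2*y := by
    rw [hq]; linear_combination 4*(2*x+y)*hzy - 4*(x+2*y)*hzx
  refine ⟨?_, ?_, ?_, ?_, ?_⟩
  · rw [hk, hD', hq]; clear * - a1 a2 a3 a4 a5 b1 b2 b3 b4 c1 c2 c3 d1 d2 e1; grind
  · rw [hk, hD', haq, hb2, hq]; clear * - a1 a2 a3 a4 a5 b1 b2 b3 b4 c1 c2 c3 d1 d2 e1; grind
  · have : 2*a*D = -6*x^2*(2*x+y) := by rw [ha, hD', hq]; clear * - a1 a2 a3 a4 a5 b1 b2 b3 b4 c1 c2 c3 d1 d2 e1; grind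
    linear_combination this + 4*Dx*hzb-4*Dy*hza-4*hzx
  · rw [hD', hq]; clear * - a1 a2 a3 a4 a5 b1 b2 b3 b4 c1 c2 c3 d1 d2 e1; grind
  · clear * - a1 a2 a3 a4 a5 b1 b2 b3 b4 c1 c2 c3 d1 d2 e1; grind

theorem pd_eq (i : Fin 3) (f : MvPowerSeries (Fin 3) ℂ) : pd i f = pderiv ℂ i f := by
  ext m
  rw [coeff_pderiv, mul_comm]
  rfl

theorem minors (φ f₁ f₂ Δ x y z a b q D Dx Dy : MvPowerSeries (Fin 3) ℂ)
    (hx : x = X 0) (hy : y = X 1) (hz : z = X 2)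
    (hφ : φ = x ^ 3 + x ^ 2 * y ^ 2 + y ^ 7 + z ^ 2)
    (hf₁ : f₁ = y + z ^ 2)
    (hf₂ : f₂ = x ^ 2 + x * y + y ^ 2)
    (ha : a = 3*x^2+2*x*y^2) (hb : b = 2*x^2*y+7*y^6) (hq : q = x + 2*y)
    (hD : D = -(2*x+y)+b*(2*x+y)-a*q)
    (hDx : Dx = -2 + (4*x*y)*(2*x+y)+2*b - (6*x+2*y^2)*q - a)
    (hDy : Dy = -1 + (2*x^2+42*y^5)*(2*x+y)+b - (4*x*y)*q - 2*a)
    (hΔ : Δ = (Matrix.of ![fun j => pd j φ, fun j => pd j f₁,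
        fun j => pd j f₂]).det)
    (M : Matrix (Fin 4) (Fin 3) (MvPowerSeries (Fin 3) ℂ))
    (hM : M = Matrix.of ![fun j => pd j φ, fun j => pd j f₁,
        fun j => pd j f₂, fun j => pd j Δ]) :
    (M.submatrix (Fin.succAbove 0) id).det = -2*(2*x+y)*D+4*z^2*((2*x+y)*Dy - q*Dx) ∧
    (M.submatrix (Fin.succAbove 1) id).det =
      2*D*(a*q-b*(2*x+y))+4*z^2*((2*x+y)*Dy - q*Dx) ∧
    (M.submatrix (Fin.succAbove 2) id).det = 2*a*D+4*z^2*(b*Dx-a*Dy-Dx) ∧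
    (M.submatrix (Fin.succAbove 3) id).det = 2*z*D := by
  have x0 : pderiv ℂ 0 x = 1 := by rw [hx]; simp
  have x1 : pderiv ℂ 1 x = 0 := by rw [hx]; simp
  have x2 : pderiv ℂ 2 x = 0 := by rw [hx]; simp
  have y0 : pderiv ℂ 0 y = 0 := by rw [hy]; simp
  have y1 : pderiv ℂ 1 y = 1 := by rw [hy]; simp
  have y2 : pderiv ℂ 2 y = 0 := by rw [hy]; simp
  have z0 : pderiv ℂ 0 z = 0 := by rw [hz]; simp
  have z1 : pderiv ℂ 1 z = 0 := by rw [hz]; simp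
  have z2 : pderiv ℂ 2 z = 1 := by rw [hz]; simp
  have n2 : ∀ i, pderiv ℂ i (2 : MvPowerSeries (Fin 3) ℂ) = 0 := fun i => (pderiv ℂ i).map_natCast 2
  have n3 : ∀ i, pderiv ℂ i (3 : MvPowerSeries (Fin 3) ℂ) = 0 := fun i => (pderiv ℂ i).map_natCast 3
  have n7 : ∀ i, pderiv ℂ i (7 : MvPowerSeries (Fin 3) ℂ) = 0 := fun i => (pderiv ℂ i).map_natCast 7
  clear hx hy hz
  have p0 : pderiv ℂ 0 φ = a := by
    rw [hφ, ha]; simp [pderiv_pow, x0, y0, z0, Derivation.leibniz]; ring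
  have p1 : pderiv ℂ 1 φ = b := by
    rw [hφ, hb]; simp [pderiv_pow, x1, y1, z1, Derivation.leibniz]; ring
  have p2 : pderiv ℂ 2 φ = 2*z := by
    rw [hφ]; simp [pderiv_pow, x2, y2, z2, Derivation.leibniz]
  have q0 : pderiv ℂ 0 f₁ = 0 := by
    rw [hf₁]; simp [pderiv_pow, x0, y0, z0, Derivation.leibniz]
  have q1 : pderiv ℂ 1 f₁ = 1 := by
    rw [hf₁]; simp [pderiv_pow, x1, y1, z1, Derivation.leibniz]
  have q2 : pderiv ℂ 2 f₁ = 2*z := by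
    rw [hf₁]; simp [pderiv_pow, x2, y2, z2, Derivation.leibniz]
  have r0 : pderiv ℂ 0 f₂ = 2*x+y := by
    rw [hf₂]; simp [pderiv_pow, x0, y0, z0, Derivation.leibniz]
  have r1 : pderiv ℂ 1 f₂ = q := by
    rw [hf₂, hq]; simp [pderiv_pow, x1, y1, z1, Derivation.leibniz]
  have r2 : pderiv ℂ 2 f₂ = 0 := by
    rw [hf₂]; simp [pderiv_pow, x2, y2, z2, Derivation.leibniz]
  have hΔ' : Δ = 2*z*D := by
    rw [hΔ, Matrix.det_fin_three, hD]
    simp [pd_eq, p0, p1, p2, q0, q1, q2, r0, r1, r2]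
    ring
  have D0 : pderiv ℂ 0 D = Dx := by
    rw [hD, hDx, ha, hb, hq]; simp [pderiv_pow, x0, y0, z0, n2, n3, n7, Derivation.leibniz]; ring
  have D1 : pderiv ℂ 1 D = Dy := by
    rw [hD, hDy, ha, hb, hq]; simp [pderiv_pow, x1, y1, z1, n2, n3, n7, Derivation.leibniz]; ring
  have D2 : pderiv ℂ 2 D = 0 := by
    rw [hD, ha, hb, hq]; simp [pderiv_pow, x2, y2, z2, n2, n3, n7, Derivation.leibniz]
  have s0 : pderiv ℂ 0 Δ = 2*z*Dx := by
    rw [hΔ']; simp [n2, z0, D0, Derivation.leibniz]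
  have s1 : pderiv ℂ 1 Δ = 2*z*Dy := by
    rw [hΔ']; simp [n2, z1, D1, Derivation.leibniz]
  have s2 : pderiv ℂ 2 Δ = 2*D := by
    rw [hΔ']; simp [n2, z2, D2, Derivation.leibniz]; ring
  have m0 : ∀ j, M 0 j = pderiv ℂ j φ := fun j => by rw [hM, ← pd_eq]; rfl
  have m1 : ∀ j, M 1 j = pderiv ℂ j f₁ := fun j => by rw [hM, ← pd_eq]; rfl
  have m2 : ∀ j, M 2 j = pderiv ℂ j f₂ := fun j => by rw [hM, ← pd_eq]; rfl
  have m3 : ∀ j, M 3 j = pderiv ℂ j Δ := fun j => by rw [hM, ← pd_eq]; rfl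
  clear hM hΔ
  have k00 : Fin.succAbove (0 : Fin 4) (0 : Fin 3) = 1 := rfl
  have k01 : Fin.succAbove (0 : Fin 4) (1 : Fin 3) = 2 := rfl
  have k02 : Fin.succAbove (0 : Fin 4) (2 : Fin 3) = 3 := rfl
  have k10 : Fin.succAbove (1 : Fin 4) (0 : Fin 3) = 0 := rfl
  have k11 : Fin.succAbove (1 : Fin 4) (1 : Fin 3) = 2 := rfl
  have k12 : Fin.succAbove (1 : Fin 4) (2 : Fin 3) = 3 := rfl
  have k20 : Fin.succAbove (2 : Fin 4) (0 : Fin 3) = 0 := rfl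
  have k21 : Fin.succAbove (2 : Fin 4) (1 : Fin 3) = 1 := rfl
  have k22 : Fin.succAbove (2 : Fin 4) (2 : Fin 3) = 3 := rfl
  have k30 : Fin.succAbove (3 : Fin 4) (0 : Fin 3) = 0 := rfl
  have k31 : Fin.succAbove (3 : Fin 4) (1 : Fin 3) = 1 := rfl
  have k32 : Fin.succAbove (3 : Fin 4) (2 : Fin 3) = 2 := rfl
  refine ⟨?_, ?_, ?_, ?_⟩ <;> rw [Matrix.det_fin_three] <;>
    simp only [Matrix.submatrix_apply, id, k00, k01, k02, k10, k11, k12, k20, k21, k22, k30, k31,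
      k32, m0, m1, m2, m3, p0, p1, p2, q0, q1, q2, r0, r1, r2, s0, s1, s2]
  · ring
  · ring
  · ring
  · rw [hD]; ring

theorem bwd {R : Type*} [CommRing R] (x y z t : R) (ht : 4*t = 1)
    (H : ∀ w : R, w = x ∨ w = y ∨ w = z → w * ((2*x+y)*z) = 0 ∧ w * (2*x+y)^2 = 0 ∧
      w * (4*z^2 - 3*x^2*(2*x+y)) = 0 ∧ w * (x^3+z^2) = 0) : Deg4 x y z := by
  obtain ⟨x1, x2, x3, x4⟩ := H x (by simp)
  obtain ⟨y1, y2, y3, y4⟩ := H y (by simp)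
  obtain ⟨z1, z2, z3, z4⟩ := H z (by simp)
  clear H
  have e1 : x^3*(2*x+y) = 0 := by linear_combination 2*x4+y4 - z1
  have e2 : z^2*x = 0 := by linear_combination t*x3-z^2*x*ht +3*t*e1
  have e3 : z^3 = 0 := by linear_combination t*z3-z^3*ht +3*t*x*x1
  have e4 : x^4 = 0 := by linear_combination x4 - e2
  have e5 : x^3*y = 0 := by linear_combination e1 - 2*e4
  have e6 : x^2*y^2 = 0 := by linear_combination x*x2 - 4*e4-4*e5
  have e7 : x*y^3 = 0 := by linear_combination y*x2 - 4*e5-4*e6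
  have e8 : y^4 = 0 := by linear_combination y*y2 - 4*e6-4*e7
  have b1 : x^3*z = 0 := by linear_combination z4 - e3
  have b2 : x^2*y*z = 0 := by linear_combination x*x1 - 2*b1
  have b3 : x*y^2*z = 0 := by linear_combination y*x1 - 2*b2
  have b4 : y^3*z = 0 := by linear_combination y*y1 - 2*b3
  have c3 : y^2*z^2 = 0 := by linear_combination y*z1 - 2*y*e2
  exact ⟨e4, e5, e6, e7, e8, b1, b2, b3, b4, by linear_combination x*e2,
    by linear_combination y*e2, c3, by linear_combination x*e3, by linear_combination y*e3,
    by linear_combination z*e3⟩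

theorem exq {S : Type} [CommRing S] (J : Ideal S) :
    ∃ (T : Type) (_ : CommRing T) (π : S →+* T), ∀ s, π s = 0 ↔ s ∈ J :=
  ⟨S ⧸ J, inferInstance, Ideal.Quotient.mk J, fun _ => Ideal.Quotient.eq_zero_iff_mem⟩

theorem ideal_eq {S : Type} [CommRing S] [IsLocalRing S]
    (φ G0 G1 G2 G3 x y z a b q D Dx Dy t : S) (I I9 : Ideal S) (t4 : 4 * t = 1)
    (hx : x ∈ IsLocalRing.maximalIdeal S) (hy : y ∈ IsLocalRing.maximalIdeal S)
    (hz : z ∈ IsLocalRing.maximalIdeal S)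
    (h9 : I9 = Ideal.span {(2*x+y)*z, (2*x+y)^2, 4*z^2 - 3*x^2*(2*x+y), x^3+z^2})
    (hI : I = Ideal.span {φ, G0, G1, G2, G3})
    (hφ : φ = x ^ 3 + x ^ 2 * y ^ 2 + y ^ 7 + z ^ 2)
    (ha : a = 3*x^2+2*x*y^2) (hb : b = 2*x^2*y+7*y^6) (hq : q = x + 2*y)
    (hD : D = -(2*x+y)+b*(2*x+y)-a*q)
    (hDx : Dx = -2 + (4*x*y)*(2*x+y)+2*b - (6*x+2*y^2)*q - a)
    (hDy : Dy = -1 + (2*x^2+42*y^5)*(2*x+y)+b - (4*x*y)*q - 2*a)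
    (hG0 : G0 = -2*(2*x+y)*D+4*z^2*((2*x+y)*Dy - q*Dx))
    (hG1 : G1 = 2*D*(a*q-b*(2*x+y))+4*z^2*((2*x+y)*Dy - q*Dx))
    (hG2 : G2 = 2*a*D+4*z^2*(b*Dx-a*Dy-Dx))
    (hG3 : G3 = 2*z*D) : I = I9 := by
  have ht : ∀ (T : Type) (_ : CommRing T) (π : S →+* T), 4 * π t = 1 := by
    intro T _ π
    have := congrArg π t4
    simpa only [map_mul, map_one, map_ofNat] using this
  have R : ∀ (T : Type) (_ : CommRing T) (π : S →+* T), _ → _ := fun T _ π H =>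
    red (π x) (π y) (π z) (π a) (π b) (π q) (π D) (π Dx) (π Dy) H
      (by simp only [ha, map_mul, map_add, map_sub, map_pow, map_ofNat, map_neg, map_one]) (by simp only [hb, map_mul, map_add, map_sub, map_pow, map_ofNat, map_neg, map_one]) (by simp only [hq, map_mul, map_add, map_sub, map_pow, map_ofNat, map_neg, map_one]) (by simp only [hD, map_mul, map_add, map_sub, map_pow, map_ofNat, map_neg, map_one])
      (by simp only [hDx, map_mul, map_add, map_sub, map_pow, map_ofNat, map_neg, map_one]) (by simp only [hDy, map_mul, map_add, map_sub, map_pow, map_ofNat, map_neg, map_one])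
  apply le_antisymm
  · obtain ⟨T, _, π, hπ⟩ := exq I9
    have m : ∀ g ∈ ({(2*x+y)*z, (2*x+y)^2, 4*z^2 - 3*x^2*(2*x+y), x^3+z^2} :
        Set (S)), π g = 0 := by
      intro g hg
      rw [hπ, h9]
      exact Ideal.subset_span hg
    have k1 := m ((2*x+y)*z) (by simp)
    have k2 := m ((2*x+y)^2) (by simp)
    have k3 := m (4*z^2 - 3*x^2*(2*x+y)) (by simp)
    have k4 := m (x^3+z^2) (by simp)
    simp only [map_mul, map_add, map_sub, map_pow, map_ofNat] at k1 k2 k3 k4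
    obtain ⟨zy, H⟩ := fwd _ _ _ _ (ht T _ π) k1 k2 (sub_eq_zero.mp k3) k4
    obtain ⟨r0, r1, r2, r3, r4⟩ := R T _ π H
    rw [hI, Ideal.span_le]
    rintro g (rfl | rfl | rfl | rfl | rfl) <;>
      rw [SetLike.mem_coe, ← hπ]
    · rw [hφ]; simp only [map_mul, map_add, map_sub, map_pow, map_ofNat, map_neg]
      rw [r4, k4]
    · rw [hG0]; simp only [map_mul, map_add, map_sub, map_pow, map_ofNat, map_neg]
      rw [r0]; linear_combination 2*k2+12*zy
    · rw [hG1]; simp only [map_mul, map_add, map_sub, map_pow, map_ofNat, map_neg]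
      rw [r1]; linear_combination 12*zy
    · rw [hG2]; simp only [map_mul, map_add, map_sub, map_pow, map_ofNat, map_neg]
      rw [r2]; linear_combination 2*k3
    · rw [hG3]; simp only [map_mul, map_add, map_sub, map_pow, map_ofNat, map_neg]
      rw [r3]; linear_combination -2*k1
  · have hfg : I9.FG := by
      rw [h9]
      exact Submodule.fg_span (by simp)
    refine Submodule.le_of_le_smul_of_le_jacobson_bot
      (I := IsLocalRing.maximalIdeal (S)) hfg
      (IsLocalRing.jacobson_eq_maximalIdeal ⊥ bot_ne_top).ge ?_
    set J : Ideal (S) :=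
      I ⊔ IsLocalRing.maximalIdeal (S) • I9 with hJ
    obtain ⟨T, _, π, hπ⟩ := exq J
    have m : ∀ w ∈ ({x, y, z} : Set (S)), 
        ∀ g ∈ ({(2*x+y)*z, (2*x+y)^2, 4*z^2 - 3*x^2*(2*x+y), x^3+z^2} :
        Set (S)), π (w * g) = 0 := by
      intro w hw g hg
      rw [hπ]
      refine Ideal.mem_sup_right (Ideal.mul_mem_mul ?_ ?_)
      · rcases hw with rfl | rfl | rfl
        · exact hx
        · exact hy
        · exact hz
      · rw [h9]
        exact Ideal.subset_span hg
    have H : Deg4 (π x) (π y) (π z) := by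
      apply bwd _ _ _ _ (ht T _ π)
      have : ∀ w ∈ ({x, y, z} : Set (S)), 
         π w * ((2 * π x + π y) * π z) = 0 ∧
        π w * (2 * π x + π y) ^ 2 = 0 ∧
        π w * (4 * π z ^ 2 - 3 * π x ^ 2 * (2 * π x + π y)) = 0 ∧
        π w * (π x ^ 3 + π z ^ 2) = 0 := by
        intro w hw
        have k1 := m w hw ((2*x+y)*z) (by simp)
        have k2 := m w hw ((2*x+y)^2) (by simp)
        have k3 := m w hw (4*z^2 - 3*x^2*(2*x+y)) (by simp)
        have k4 := m w hw (x^3+z^2) (by simp)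
        simp only [map_mul, map_add, map_sub, map_pow, map_ofNat] at k1 k2 k3 k4
        exact ⟨k1, k2, k3, k4⟩
      rintro w (rfl | rfl | rfl)
      · exact this x (by simp)
      · exact this y (by simp)
      · exact this z (by simp)
    obtain ⟨r0, r1, r2, r3, r4⟩ := R T _ π H
    have n : ∀ g ∈ ({φ, G0, G1, G2, G3} : Set (S)),
        π g = 0 := by
      intro g hg
      rw [hπ]
      refine Ideal.mem_sup_left ?_
      rw [hI]
      exact Ideal.subset_span hg
    have n0 := n φ (by simp)
    have n1 := n G0 (by simp)
    have n2 := n G1 (by simp)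
    have n3 := n G2 (by simp)
    have n4 := n G3 (by simp)
    rw [hφ] at n0
    rw [hG0] at n1
    rw [hG1] at n2
    rw [hG2] at n3
    rw [hG3] at n4
    simp only [map_mul, map_add, map_sub, map_pow, map_ofNat, map_neg] at n0 n1 n2 n3 n4
    rw [r4] at n0
    rw [r0] at n1
    rw [r1] at n2
    rw [r2] at n3
    rw [r3] at n4
    replace t4 := ht T _ π
    generalize π t = t at t4
    rw [h9, Ideal.span_le]
    rintro g (rfl | rfl | rfl | rfl) <;>
      rw [SetLike.mem_coe, ← hπ] <;>
      simp only [map_mul, map_add, map_sub, map_pow, map_ofNat, map_neg]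
    · generalize (2 * π x + π y) * π z = v at *
      linear_combination -2*t*n4 - v*t4
    · linear_combination 2*t*(n1-n2) - (2 * π x + π y)^2*t4
    · linear_combination 2*t*n3 - (4 * π z ^ 2 - 3 * π x ^ 2 * (2 * π x + π y))*t4
    · exact n0

/-- The simplified ideal. -/
noncomputable def I9 : Ideal (MvPowerSeries (Fin 3) ℂ) :=
  Ideal.span {(2*X 0+X 1)*X 2, (2*X 0+X 1)^2, 4*X 2^2 - 3*X 0^2*(2*X 0+X 1), X 0^3+X 2^2}

theorem four_inv : (4 : MvPowerSeries (Fin 3) ℂ) * C (1/4) = 1 := by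
  have : (4 : MvPowerSeries (Fin 3) ℂ) = C (4:ℂ) := (map_ofNat (C : ℂ →+* MvPowerSeries (Fin 3) ℂ) 4).symm
  rw [this, ← map_mul]; norm_num


/-- Coefficient of `x^a y^b z^d`. -/
noncomputable def cf (a b d : ℕ) : MvPowerSeries (Fin 3) ℂ →ₗ[ℂ] ℂ :=
  coeff (Finsupp.single 0 a + Finsupp.single 1 b + Finsupp.single 2 d)

theorem cf_x_succ (a b d : ℕ) (h : MvPowerSeries (Fin 3) ℂ) :
    cf (a+1) b d (X 0 * h) = cf a b d h := by
  have : (Finsupp.single 0 (a+1) + Finsupp.single 1 b + Finsupp.single 2 d : Fin 3 →₀ ℕ) =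
    Finsupp.single 0 1 + (Finsupp.single 0 a + Finsupp.single 1 b + Finsupp.single 2 d) := by
    rw [Finsupp.single_add]; abel
  rw [cf, cf, this, X, coeff_add_monomial_mul, one_mul]

theorem cf_y_succ (a b d : ℕ) (h : MvPowerSeries (Fin 3) ℂ) :
    cf a (b+1) d (X 1 * h) = cf a b d h := by
  have : (Finsupp.single 0 a + Finsupp.single 1 (b+1) + Finsupp.single 2 d : Fin 3 →₀ ℕ) =
    Finsupp.single 1 1 + (Finsupp.single 0 a + Finsupp.single 1 b + Finsupp.single 2 d) := by
    rw [Finsupp.single_add]; abel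
  rw [cf, cf, this, X, coeff_add_monomial_mul, one_mul]

theorem cf_z_succ (a b d : ℕ) (h : MvPowerSeries (Fin 3) ℂ) :
    cf a b (d+1) (X 2 * h) = cf a b d h := by
  have : (Finsupp.single 0 a + Finsupp.single 1 b + Finsupp.single 2 (d+1) : Fin 3 →₀ ℕ) =
    Finsupp.single 2 1 + (Finsupp.single 0 a + Finsupp.single 1 b + Finsupp.single 2 d) := by
    rw [Finsupp.single_add]; abel
  rw [cf, cf, this, X, coeff_add_monomial_mul, one_mul]

theorem cf_x_zero (b d : ℕ) (h : MvPowerSeries (Fin 3) ℂ) : cf 0 b d (X 0 * h) = 0 := by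
  classical
  rw [cf, X, coeff_monomial_mul, if_neg]
  intro hh
  simpa using hh 0

theorem cf_y_zero (a d : ℕ) (h : MvPowerSeries (Fin 3) ℂ) : cf a 0 d (X 1 * h) = 0 := by
  classical
  rw [cf, X, coeff_monomial_mul, if_neg]
  intro hh
  simpa using hh 1

theorem cf_z_zero (a b : ℕ) (h : MvPowerSeries (Fin 3) ℂ) : cf a b 0 (X 2 * h) = 0 := by
  classical
  rw [cf, X, coeff_monomial_mul, if_neg]
  intro hh
  simpa using hh 2

theorem cf_one (a b d : ℕ) : cf a b d 1 = if a = 0 ∧ b = 0 ∧ d = 0 then 1 else 0 := by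
  classical
  rw [cf, coeff_one]
  congr 1
  rw [eq_iff_iff, Finsupp.ext_iff, Fin.forall_fin_succ, Fin.forall_fin_succ, Fin.forall_fin_succ]
  simp

theorem cf_ext (f g : MvPowerSeries (Fin 3) ℂ) (h : ∀ a b d, cf a b d f = cf a b d g) : f = g := by
  ext m
  have : m = Finsupp.single 0 (m 0) + Finsupp.single 1 (m 1) + Finsupp.single 2 (m 2) := by
    rw [Finsupp.ext_iff, Fin.forall_fin_succ, Fin.forall_fin_succ, Fin.forall_fin_succ]
    simp
  rw [this]
  exact h _ _ _

theorem cf_mk (F : ℕ → ℕ → ℕ → ℂ) : ∃ f : MvPowerSeries (Fin 3) ℂ, ∀ a b d, cf a b d f = F a b d := by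
  refine ⟨fun m => F (m 0) (m 1) (m 2), fun a b d => ?_⟩
  rw [cf]
  change F _ _ _ = _
  simp

theorem decomp (f : MvPowerSeries (Fin 3) ℂ) : ∃ (c : ℂ) (p q r : MvPowerSeries (Fin 3) ℂ),
    f = c • 1 + (X 0 * p + (2 * X 0 + X 1) * q + X 2 * r) := by
  obtain ⟨p, hp⟩ := cf_mk fun a b d => cf (a+1) b d f
  obtain ⟨q, hq⟩ := cf_mk fun a b d => if a = 0 then cf a (b+1) d f else 0
  obtain ⟨r, hr⟩ := cf_mk fun a b d => if a = 0 ∧ b = 0 then cf a b (d+1) f else 0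
  refine ⟨cf 0 0 0 f, p - 2 * q, q, r, ?_⟩
  have : X 0 * (p - 2 * q) + (2 * X 0 + X 1) * q + X 2 * r = X 0 * p + X 1 * q + X 2 * r := by ring
  rw [this]
  apply cf_ext
  intro a b d
  simp only [map_add, map_smul, cf_one, smul_eq_mul]
  rcases a with _ | a <;> rcases b with _ | b <;> rcases d with _ | d <;>
    simp [cf_x_succ, cf_y_succ, cf_z_succ, cf_x_zero, cf_y_zero, cf_z_zero, hp, hq, hr]

/-- The coordinate functionals on the quotient. -/
noncomputable def L9 (f : MvPowerSeries (Fin 3) ℂ) : Fin 9 → ℂ :=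
  ![cf 0 0 0 f, cf 1 0 0 f - 2 * cf 0 1 0 f, cf 2 0 0 f - 2 * cf 1 1 0 f + 4 * cf 0 2 0 f,
    cf 0 1 0 f, cf 1 1 0 f - 4 * cf 0 2 0 f,
    -(3/4) * cf 3 0 0 f + 5/2 * cf 2 1 0 f - 7 * cf 1 2 0 f + 18 * cf 0 3 0 f + 3/4 * cf 0 0 2 f,
    cf 0 0 1 f, cf 1 0 1 f - 2 * cf 0 1 1 f,
    cf 2 0 1 f - 2 * cf 1 1 1 f + 4 * cf 0 2 1 f]

theorem L9_add (f g : MvPowerSeries (Fin 3) ℂ) : L9 (f + g) = L9 f + L9 g := by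
  ext i
  fin_cases i <;> simp [L9] <;> ring

theorem L9_I9 (f : MvPowerSeries (Fin 3) ℂ) (hf : f ∈ I9) : L9 f = 0 := by
  have key : ∀ h, L9 (f * h) = 0 := by
    rw [I9] at hf
    induction hf using Submodule.span_induction with
    | zero => intro h; ext i; fin_cases i <;> simp [L9]
    | add f g _ _ hf hg => intro h; rw [add_mul, L9_add, hf, hg, add_zero]
    | smul a f _ hf => intro h; rw [smul_eq_mul, mul_comm a f, mul_assoc, hf]
    | mem f hf =>
      intro h
      rcases hf with rfl | rfl | rfl | rfl
      · have : (2*X 0+X 1)*X 2*h = 2 • (X 0 * (X 2 * h)) + X 1 * (X 2 * h) := by ring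
        rw [this]
        ext i
        fin_cases i <;> simp [-nsmul_eq_mul, L9, cf_x_succ, cf_y_succ, cf_z_succ, cf_x_zero, cf_y_zero, cf_z_zero] <;> ring
      · have : (2*X 0+X 1)^2*h = 4 • (X 0 * (X 0 * h)) + 4 • (X 0 * (X 1 * h)) + X 1 * (X 1 * h) := by
          ring
        rw [this]
        ext i
        fin_cases i <;> simp [-nsmul_eq_mul, L9, cf_x_succ, cf_y_succ, cf_z_succ, cf_x_zero, cf_y_zero, cf_z_zero] <;> ring
      · have : (4*X 2^2 - 3*X 0^2*(2*X 0+X 1))*h =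
            4 • (X 2 * (X 2 * h)) - 6 • (X 0 * (X 0 * (X 0 * h))) - 3 • (X 0 * (X 0 * (X 1 * h))) := by
          ring
        rw [this]
        ext i
        fin_cases i <;> simp [-nsmul_eq_mul, L9, cf_x_succ, cf_y_succ, cf_z_succ, cf_x_zero, cf_y_zero, cf_z_zero] <;> ring
      · have : (X 0^3+X 2^2)*h = X 0 * (X 0 * (X 0 * h)) + X 2 * (X 2 * h) := by
          ring
        rw [this]
        ext i
        fin_cases i <;> simp [-nsmul_eq_mul, L9, cf_x_succ, cf_y_succ, cf_z_succ, cf_x_zero, cf_y_zero, cf_z_zero] <;> ring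
  simpa using key 1

/-- The basis of the quotient. -/
noncomputable def bs : Fin 9 → MvPowerSeries (Fin 3) ℂ :=
  ![1, X 0, X 0 * X 0, 2 * X 0 + X 1, X 0 * (2 * X 0 + X 1), X 0 * X 0 * (2 * X 0 + X 1),
    X 2, X 0 * X 2, X 0 * X 0 * X 2]

theorem L9_bs (v : Fin 9 → ℂ) : L9 (Fintype.linearCombination ℂ bs v) = v := by
  have : Fintype.linearCombination ℂ bs v = v 0 • 1 + v 1 • (X 0 * 1) + v 2 • (X 0 * (X 0 * 1)) +
      v 3 • (2 • (X 0 * 1) + X 1 * 1) + v 4 • (2 • (X 0 * (X 0 * 1)) + X 0 * (X 1 * 1)) +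
      v 5 • (2 • (X 0 * (X 0 * (X 0 * 1))) + X 0 * (X 0 * (X 1 * 1))) +
      v 6 • (X 2 * 1) + v 7 • (X 0 * (X 2 * 1)) + v 8 • (X 0 * (X 0 * (X 2 * 1))) := by
    rw [Fintype.linearCombination_apply, Fin.sum_univ_succ, Fin.sum_univ_eight, ← add_assoc, ← add_assoc, ← add_assoc, ← add_assoc, ← add_assoc, ← add_assoc, ← add_assoc]
    change v 0 • bs 0 + v 1 • bs 1 + v 2 • bs 2 + v 3 • bs 3 + v 4 • bs 4 + v 5 • bs 5 + v 6 • bs 6 + v 7 • bs 7 + v 8 • bs 8 = _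
    have h3 : bs 3 = 2 • (X 0 * 1) + X 1 * 1 := by change 2 * X 0 + X 1 = _; ring
    have h4 : bs 4 = 2 • (X 0 * (X 0 * 1)) + X 0 * (X 1 * 1) := by
      change X 0 * (2 * X 0 + X 1) = _; ring
    have h5 : bs 5 = 2 • (X 0 * (X 0 * (X 0 * 1))) + X 0 * (X 0 * (X 1 * 1)) := by
      change X 0 * X 0 * (2 * X 0 + X 1) = _; ring
    rw [h3, h4, h5]
    simp [bs, mul_assoc]
  rw [this]
  ext i
  fin_cases i <;> simp only [L9, map_add, map_smul, map_nsmul, cf_x_succ, cf_y_succ, cf_z_succ, cf_x_zero, cf_y_zero, cf_z_zero, cf_one] <;> simp <;> ring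

theorem span9 (f : MvPowerSeries (Fin 3) ℂ) :
    ∃ v, f - Fintype.linearCombination ℂ bs v ∈ I9 := by
  let W : Submodule ℂ (MvPowerSeries (Fin 3) ℂ) :=
    LinearMap.range (Fintype.linearCombination ℂ bs) ⊔ I9.restrictScalars ℂ
  suffices hW : f ∈ W by
    obtain ⟨a, ⟨v, rfl⟩, b, hb, rfl⟩ := Submodule.mem_sup.mp hW
    refine ⟨v, ?_⟩
    rw [add_sub_cancel_left]
    exact hb
  have hI : ∀ g ∈ I9, ∀ h, g * h ∈ W := fun g hg h =>
    Submodule.mem_sup_right (I9.mul_mem_right h hg)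
  have hB : ∀ i, bs i ∈ W := fun i => by
    refine Submodule.mem_sup_left ⟨Pi.single i 1, ?_⟩
    rw [Fintype.linearCombination_apply_single, one_smul]
  obtain ⟨x, hx⟩ : ∃ x : MvPowerSeries (Fin 3) ℂ, x = X 0 := ⟨_, rfl⟩
  obtain ⟨u, hu⟩ : ∃ u : MvPowerSeries (Fin 3) ℂ, u = 2 * X 0 + X 1 := ⟨_, rfl⟩
  obtain ⟨z, hz⟩ : ∃ z : MvPowerSeries (Fin 3) ℂ, z = X 2 := ⟨_, rfl⟩
  have b0 : (1 : MvPowerSeries (Fin 3) ℂ) ∈ W := hB 0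
  have b1 : x ∈ W := hx ▸ hB 1
  have b2 : x * x ∈ W := hx ▸ hB 2
  have b3 : u ∈ W := hu ▸ hB 3
  have b4 : x * u ∈ W := by rw [hx, hu]; exact hB 4
  have b5 : x * x * u ∈ W := by rw [hx, hu]; exact hB 5
  have b6 : z ∈ W := hz ▸ hB 6
  have b7 : x * z ∈ W := by rw [hx, hz]; exact hB 7
  have b8 : x * x * z ∈ W := by rw [hx, hz]; exact hB 8
  have step : ∀ g ∈ W, (∀ h, g * x * h ∈ W) → (∀ h, g * u * h ∈ W) → (∀ h, g * z * h ∈ W) →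
      ∀ h, g * h ∈ W := by
    intro g hg h1 h2 h3 h
    obtain ⟨c, p, q, r, e⟩ := decomp h
    rw [← hu, ← hx, ← hz] at e
    have : g * h = c • g + (g * x * p + g * u * q + g * z * r) := by
      rw [e, mul_add, mul_smul_comm, mul_one]; ring
    rw [this]
    exact W.add_mem (W.smul_mem c hg) (W.add_mem (W.add_mem (h1 p) (h2 q)) (h3 r))
  have i1 : u * z ∈ I9 := by rw [hu, hz]; exact Ideal.subset_span (by simp)
  have i2 : u^2 ∈ I9 := by rw [hu]; exact Ideal.subset_span (by simp)
  have i3 : 4*z^2 - 3*x^2*u ∈ I9 := by rw [hu, hx, hz]; exact Ideal.subset_span (by simp)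
  have i4 : x^3+z^2 ∈ I9 := by rw [hx, hz]; exact Ideal.subset_span (by simp)
  have t4 := four_inv
  clear_value W
  generalize (C (1/4) : MvPowerSeries (Fin 3) ℂ) = t at t4
  clear hx hu hz
  have j1 : x * x * u * x ∈ I9 := by
    have : x * x * u * x = u * (x^3+z^2) - z * (u * z) := by ring
    rw [this]; exact I9.sub_mem (I9.mul_mem_left _ i4) (I9.mul_mem_left _ i1)
  have j2 : x * x * u * u ∈ I9 := by
    have : x * x * u * u = x * x * u^2 := by ring
    rw [this]; exact I9.mul_mem_left _ i2
  have j3 : x * x * u * z ∈ I9 := by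
    have : x * x * u * z = x * x * (u * z) := by ring
    rw [this]; exact I9.mul_mem_left _ i1
  have s5 := step _ b5 (hI _ j1) (hI _ j2) (hI _ j3)
  have szz : ∀ h, z * z * h ∈ W := by
    intro h
    have : z * z * h = (4*z^2 - 3*x^2*u) * (t * h) + x * x * u * (3 * t * h) := by
      linear_combination (-z^2*h) * t4
    rw [this]; exact W.add_mem (hI _ i3 _) (s5 _)
  have sxxx : ∀ h, x * x * x * h ∈ W := by
    intro h
    have : x * x * x * h = (x^3+z^2) * h - z * z * h := by ring
    rw [this]; exact W.sub_mem (hI _ i4 _) (szz _)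
  have suz : ∀ h, u * z * h ∈ W := hI _ i1
  have suu : ∀ h, u * u * h ∈ W := by rw [← pow_two]; exact hI _ i2
  have sw : ∀ g k, (∀ h, g * h ∈ W) → (∃ l, k = g * l) → ∀ h, k * h ∈ W := by
    rintro g k hg ⟨l, rfl⟩ h
    rw [mul_assoc]; exact hg _
  have s8 := step _ b8 
    (fun h => by rw [show x * x * z * x * h = x * x * x * (z * h) by ring]; exact sxxx _)
    (sw _ _ suz ⟨x * x, by ring⟩)
    (sw _ _ szz ⟨x * x, by ring⟩)
  have s2 := step _ b2 sxxx s5 s8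
  have s4 := step _ b4 (sw _ _ s5 ⟨1, by ring⟩) (sw _ _ suu ⟨x, by ring⟩) (sw _ _ suz ⟨x, by ring⟩)
  have s7 := step _ b7 (sw _ _ s8 ⟨1, by ring⟩) (sw _ _ suz ⟨x, by ring⟩) (sw _ _ szz ⟨x, by ring⟩)
  have s1 := step _ b1 s2 s4 s7
  have s3 := step _ b3 (sw _ _ s4 ⟨1, by ring⟩) suu suz
  have s6 := step _ b6 (sw _ _ s7 ⟨1, by ring⟩) (sw _ _ suz ⟨1, by ring⟩) szz
  have s0 := step _ b0 (by simpa using s1) (by simpa using s3) (by simpa using s6)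
  simpa using s0 f

theorem finrank9 : Module.finrank ℂ (MvPowerSeries (Fin 3) ℂ ⧸ I9) = 9 := by
  let T : (Fin 9 → ℂ) →ₗ[ℂ] (MvPowerSeries (Fin 3) ℂ ⧸ I9) :=
    (Ideal.Quotient.mkₐ ℂ I9).toLinearMap ∘ₗ Fintype.linearCombination ℂ bs
  have hT : ∀ v, T v = Ideal.Quotient.mk I9 (Fintype.linearCombination ℂ bs v) := fun v => rfl
  have inj : Function.Injective T := by
    rw [injective_iff_map_eq_zero]
    intro v hv
    rw [hT, Ideal.Quotient.eq_zero_iff_mem] at hv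
    rw [← L9_bs v, L9_I9 _ hv]
  have surj : Function.Surjective T := by
    intro a
    obtain ⟨f, rfl⟩ := Ideal.Quotient.mk_surjective a
    obtain ⟨v, hv⟩ := span9 f
    exact ⟨v, ((Ideal.Quotient.eq).mpr hv).symm⟩
  rw [← (LinearEquiv.ofBijective T ⟨inj, surj⟩).finrank_eq]
  simp

theorem stmt14 (φ f₁ f₂ Δ : MvPowerSeries (Fin 3) ℂ)
    (hφ : φ = X 0 ^ 3 + X 0 ^ 2 * X 1 ^ 2 + X 1 ^ 7 + X 2 ^ 2)
    (hf₁ : f₁ = X 1 + X 2 ^ 2)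
    (hf₂ : f₂ = X 0 ^ 2 + X 0 * X 1 + X 1 ^ 2)
    -- `Δ` is the determinant of the Jacobian of `(φ,f₁,f₂) : ℂ³ → ℂ³`
    (hΔ : Δ = (Matrix.of ![fun j => pd j φ, fun j => pd j f₁,
        fun j => pd j f₂]).det)
    (M : Matrix (Fin 4) (Fin 3) (MvPowerSeries (Fin 3) ℂ))
    -- `M` is the Jacobian matrix of `(φ,f₁,f₂,Δ) : ℂ³ → ℂ⁴`
    (hM : M = Matrix.of ![fun j => pd j φ, fun j => pd j f₁,
        fun j => pd j f₂, fun j => pd j Δ])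
    (JφfΔ : Ideal (MvPowerSeries (Fin 3) ℂ))
    -- `J(φ,f,Δ)` is generated by the four `3×3` minors of `M`
    (hJ : JφfΔ = Ideal.span
      (Set.range fun i : Fin 4 => (M.submatrix i.succAbove id).det)) :
    Module.finrank ℂ
      (MvPowerSeries (Fin 3) ℂ ⧸ (Ideal.span {φ} ⊔ JφfΔ)) = 9 := by
  
  obtain ⟨g0, g1, g2, g3⟩ := minors φ f₁ f₂ Δ (X 0) (X 1) (X 2) _ _ _ _ _ _ rfl rfl rfl
    hφ hf₁ hf₂ rfl rfl rfl rfl rfl rfl hΔ M hM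
  have mm : ∀ i : Fin 3, (X i : MvPowerSeries (Fin 3) ℂ) ∈
      IsLocalRing.maximalIdeal (MvPowerSeries (Fin 3) ℂ) := by
    intro i
    rw [IsLocalRing.mem_maximalIdeal, mem_nonunits_iff, isUnit_iff_constantCoeff]
    simp
  have hI : Ideal.span {φ} ⊔ JφfΔ = I9 := by
    refine ideal_eq φ _ _ _ _ (X 0) (X 1) (X 2) _ _ _ _ _ _ _ _ I9 four_inv (mm 0) (mm 1) (mm 2)
      rfl ?_ hφ rfl rfl rfl rfl rfl rfl g0 g1 g2 g3
    rw [hJ, ← Ideal.span_union]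
    congr 1
    ext g
    simp only [Set.mem_union, Set.mem_singleton_iff, Set.mem_range, Set.mem_insert_iff,
      Fin.exists_fin_succ]
    simp [eq_comm]
  rw [hI]
  exact finrank9
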